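/- Assume in addition that d_q ∘ d_q = 0, and let π_H : B⊗̂V → B⊗̂H denote the projection onto B⊗̂H along d_q(B⊗̂R) ⊕ (B⊗̂R). Then π_H ∘ d_q = D ∘ π_H and the map ψ : B⊗̂H → B⊗̂V, ψ(h) = h − E(h), satisfies d_q ∘ ψ = ψ ∘ D; moreover π_H maps ker(d_q) into ker(D) and range(d_q) into range(D), and the induced B-module map ker(d_q)/range(d_q) → ker(D)/range(D) is an isomorphism, with inverse induced by ψ. -/

import Mathlib

/-!
`B` is a "deformation base": a commutative Noetherian local ℂ-algebra, complete in the
`𝔪`-adic topology, with residue field `ℂ`.  For a ℂ-vector space `X`, the completed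
tensor product `B ⊗̂ X` is the `𝔪`-adic completion of `B ⊗[ℂ] X`, realized as the
inverse limit of the modules `(B ⊗[ℂ] X) ⧸ 𝔪^k (B ⊗[ℂ] X) ≅ B/𝔪^k ⊗[ℂ] X`.
-/

open scoped TensorProduct
open IsLocalRing

/-- The completed tensor product `B ⊗̂ X`. -/
noncomputable abbrev CTP (B : Type) [CommRing B] [Algebra ℂ B] [IsLocalRing B]
    (X : Type) [AddCommGroup X] [Module ℂ X] : Type :=
  AdicCompletion (maximalIdeal B) (B ⊗[ℂ] X)

/-- The canonical embedding `X → B ⊗̂ X`, `x ↦ 1 ⊗ x`. -/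
noncomputable def iota (B : Type) [CommRing B] [Algebra ℂ B] [IsLocalRing B]
    (X : Type) [AddCommGroup X] [Module ℂ X] (x : X) : CTP B X :=
  AdicCompletion.of (maximalIdeal B) (B ⊗[ℂ] X) ((1 : B) ⊗ₜ x)

/-- The submodule `𝔪^k X ⊆ B ⊗̂ X`: the kernel of the canonical projection
`B ⊗̂ X → (B ⊗[ℂ] X) ⧸ 𝔪^k (B ⊗[ℂ] X) ≅ B/𝔪^k ⊗[ℂ] X`. -/
noncomputable def mpow (B : Type) [CommRing B] [Algebra ℂ B] [IsLocalRing B]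
    (X : Type) [AddCommGroup X] [Module ℂ X] (k : ℕ) : Submodule B (CTP B X) :=
  LinearMap.ker (AdicCompletion.eval (maximalIdeal B) (B ⊗[ℂ] X) k)

/-- The `𝔪`-adic topology on `B ⊗̂ X`, generated by the cosets `x + 𝔪^k X`. -/
noncomputable def adicTop (B : Type) [CommRing B] [Algebra ℂ B] [IsLocalRing B]
    (X : Type) [AddCommGroup X] [Module ℂ X] : TopologicalSpace (CTP B X) :=
  TopologicalSpace.generateFrom
    {s | ∃ (x : CTP B X) (k : ℕ), s = {y | y - x ∈ mpow B X k}}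

/-- For a ℂ-subspace `W ⊆ V`, the `B`-submodule `B ⊗̂ W ⊆ B ⊗̂ V`: those elements all of
whose finite-level components `(B ⊗[ℂ] V) ⧸ 𝔪^n (B ⊗[ℂ] V)` come from `B ⊗[ℂ] W`. -/
noncomputable def csub (B : Type) [CommRing B] [Algebra ℂ B] [IsLocalRing B]
    (V : Type) [AddCommGroup V] [Module ℂ V] (W : Submodule ℂ V) :
    Submodule B (CTP B V) :=
  ⨅ n : ℕ, Submodule.comap
    (AdicCompletion.eval (maximalIdeal B) (B ⊗[ℂ] V) n)
    (LinearMap.range ((Submodule.mkQ ((maximalIdeal B) ^ n • ⊤)).comp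
      ((W.subtype).baseChange B)))

section CompletedTensor

variable {B : Type} [CommRing B] [Algebra ℂ B] [IsLocalRing B]
  {V : Type} [AddCommGroup V] [Module ℂ V]

/-- The `B`-linear extension of a `ℂ`-linear endomorphism of `V` to `B ⊗̂ V`. -/
noncomputable def completedMap (B : Type) [CommRing B] [Algebra ℂ B] [IsLocalRing B]
    {V : Type} [AddCommGroup V] [Module ℂ V] (f : V →ₗ[ℂ] V) : CTP B V →ₗ[B] CTP B V where
  toFun := AdicCompletion.map (maximalIdeal B) (f.baseChange B)
  map_add' := map_add _
  map_smul' b x := LinearMap.map_smul_of_tower _ b x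

theorem eval_completedMap (f : V →ₗ[ℂ] V) {x : CTP B V} {n : ℕ} {t : B ⊗[ℂ] V}
    (ht : (maximalIdeal B ^ n • ⊤ : Submodule B (B ⊗[ℂ] V)).mkQ t =
      AdicCompletion.eval (maximalIdeal B) (B ⊗[ℂ] V) n x) :
    AdicCompletion.eval (maximalIdeal B) (B ⊗[ℂ] V) n (completedMap B f x) =
      (maximalIdeal B ^ n • ⊤ : Submodule B (B ⊗[ℂ] V)).mkQ (f.baseChange B t) := by
  rw [AdicCompletion.eval_apply] at ht ⊢
  change (AdicCompletion.map (maximalIdeal B) (f.baseChange B) x).val n = _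
  rw [AdicCompletion.map_val_apply, ← ht]
  rfl

theorem completedMap_iota (f : V →ₗ[ℂ] V) (v : V) :
    completedMap B f (iota B V v) = iota B V (f v) := by
  change AdicCompletion.map (maximalIdeal B) (f.baseChange B) (AdicCompletion.of _ _ _) = _
  rw [AdicCompletion.map_of, LinearMap.baseChange_tmul]
  rfl

theorem completedMap_mem_mpow (f : V →ₗ[ℂ] V) {k : ℕ} {x : CTP B V} (hx : x ∈ mpow B V k) :
    completedMap B f x ∈ mpow B V k := by
  have hx' : AdicCompletion.eval (maximalIdeal B) (B ⊗[ℂ] V) k x = 0 := hx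
  change AdicCompletion.eval (maximalIdeal B) (B ⊗[ℂ] V) k _ = 0
  rw [eval_completedMap f (t := 0) (by rw [hx', map_zero]), map_zero, map_zero]

theorem completedMap_comp_apply (f g : V →ₗ[ℂ] V) (x : CTP B V) :
    completedMap B f (completedMap B g x) = completedMap B (f ∘ₗ g) x := by
  change AdicCompletion.map _ _ (AdicCompletion.map _ _ x) = AdicCompletion.map _ _ x
  rw [AdicCompletion.map_comp_apply, LinearMap.baseChange_comp]

/-- Endomorphisms of `V` which agree on `W` have extensions which agree on `B ⊗̂ W`. -/
theorem completedMap_eq_of_mem_csub {W : Submodule ℂ V} {f g : V →ₗ[ℂ] V}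
    (hfg : ∀ w ∈ W, f w = g w) {x : CTP B V} (hx : x ∈ csub B V W) :
    completedMap B f x = completedMap B g x := by
  refine AdicCompletion.ext fun n => ?_
  obtain ⟨t, ht⟩ := (Submodule.mem_iInf _).1 hx n
  rw [← AdicCompletion.eval_apply, ← AdicCompletion.eval_apply, eval_completedMap f ht,
    eval_completedMap g ht]
  have hW : f ∘ₗ W.subtype = g ∘ₗ W.subtype := LinearMap.ext fun w => hfg w w.2
  have hB := LinearMap.congr_fun (congrArg (LinearMap.baseChange B) hW) t
  rw [LinearMap.baseChange_comp, LinearMap.baseChange_comp] at hB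
  exact congrArg _ hB

theorem completedMap_id (x : CTP B V) : completedMap B LinearMap.id x = x := by
  change AdicCompletion.map _ _ x = x
  rw [LinearMap.baseChange_id, AdicCompletion.map_id]
  rfl

theorem completedMap_zero (x : CTP B V) : completedMap B (0 : V →ₗ[ℂ] V) x = 0 := by
  change AdicCompletion.map _ _ x = 0
  rw [LinearMap.baseChange_zero, AdicCompletion.map_zero]
  rfl

theorem eq_zero_of_forall_mem_mpow {x : CTP B V} (hx : ∀ k, x ∈ mpow B V k) : x = 0 :=
  AdicCompletion.ext fun n => hx n

section Noetherian

variable [IsNoetherianRing B]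

theorem mpow_eq_pow_smul_top (k : ℕ) :
    mpow B V k = maximalIdeal B ^ k • (⊤ : Submodule B (CTP B V)) :=
  (AdicCompletion.pow_smul_top_eq_ker_eval (maximalIdeal B).fg_of_isNoetherianRing).symm

theorem map_mem_mpow (δ : CTP B V →ₗ[B] CTP B V) {k : ℕ} {x : CTP B V} (hx : x ∈ mpow B V k) :
    δ x ∈ mpow B V k := by
  rw [mpow_eq_pow_smul_top] at hx ⊢
  have h := Submodule.mem_map_of_mem (f := δ) hx
  rw [Submodule.map_smul''] at h
  exact Submodule.smul_mono le_rfl le_top h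

/-- A map with zero leading term takes values in `𝔪 V`. -/
theorem map_mem_mpow_one {δ : CTP B V →ₗ[B] CTP B V}
    (hδ : ∀ v, δ (iota B V v) ∈ mpow B V 1) (x : CTP B V) : δ x ∈ mpow B V 1 := by
  have hof (t : B ⊗[ℂ] V) : δ (AdicCompletion.of (maximalIdeal B) _ t) ∈ mpow B V 1 := by
    induction t with
    | zero => simp
    | add s t hs ht => rw [map_add, map_add]; exact add_mem hs ht
    | tmul b v =>
      have hb : b ⊗ₜ[ℂ] v = b • ((1 : B) ⊗ₜ[ℂ] v) := by simp [TensorProduct.smul_tmul']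
      rw [hb, map_smul, map_smul]
      exact Submodule.smul_mem _ _ (hδ v)
  obtain ⟨t, ht⟩ := Submodule.mkQ_surjective _
    (AdicCompletion.eval (maximalIdeal B) (B ⊗[ℂ] V) 1 x)
  have hxt : x - AdicCompletion.of (maximalIdeal B) _ t ∈ mpow B V 1 := by
    rw [mpow, LinearMap.mem_ker, map_sub, AdicCompletion.eval_of, ht, sub_self]
  have h := add_mem (map_mem_mpow δ hxt) (hof t)
  rwa [← map_add, sub_add_cancel] at h

/-- A map with zero leading term raises the `𝔪`-adic filtration by one. -/
theorem map_mem_mpow_succ {δ : CTP B V →ₗ[B] CTP B V}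
    (hδ : ∀ v, δ (iota B V v) ∈ mpow B V 1) {k : ℕ} {x : CTP B V} (hx : x ∈ mpow B V k) :
    δ x ∈ mpow B V (k + 1) := by
  rw [mpow_eq_pow_smul_top] at hx ⊢
  have h := Submodule.mem_map_of_mem (f := δ) hx
  rw [Submodule.map_smul''] at h
  rw [pow_succ, Submodule.mul_smul]
  refine Submodule.smul_mono le_rfl ?_ h
  rintro _ ⟨y, -, rfl⟩
  have hy := map_mem_mpow_one hδ y
  rwa [mpow_eq_pow_smul_top, pow_one] at hy

end Noetherian

end CompletedTensor

/-- A homological splitting `V = H ⊕ I ⊕ R` of `d` has a contraction: a map inverting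
`d : R → I` and vanishing on `H ⊕ R`. -/
theorem exists_contraction {V : Type} [AddCommGroup V] [Module ℂ V]
    {H I R : Submodule ℂ V} {d : V →ₗ[ℂ] V} (hsup : H ⊔ I ⊔ R = ⊤)
    (hdisjH : Disjoint H (I ⊔ R)) (hdisjIR : Disjoint I R)
    (hI : I = LinearMap.range d) (hker : LinearMap.ker d = H ⊔ I) :
    ∃ s : V →ₗ[ℂ] V, (∀ v ∈ H, s v = 0) ∧ (∀ v ∈ R, s v = 0) ∧ ∀ v ∈ R, s (d v) = v := by
  have hR : Disjoint (H ⊔ I) R := hdisjIR.disjoint_sup_left_of_disjoint_sup_right hdisjH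
  have hIHR : IsCompl I (H ⊔ R) := by
    refine ⟨?_, codisjoint_iff.2 (by rw [← sup_assoc, sup_comm I H, hsup])⟩
    exact (hdisjIR.symm.disjoint_sup_left_of_disjoint_sup_right
      (by rwa [sup_comm])).symm
  have hinj : LinearMap.ker (d ∘ₗ R.subtype) = ⊥ := by
    rw [LinearMap.ker_eq_bot']
    intro r hr
    exact Subtype.ext (Submodule.disjoint_def.1 hR r (hker ▸ hr) r.2)
  obtain ⟨g, hg⟩ := LinearMap.exists_leftInverse_of_injective _ hinj
  refine ⟨R.subtype ∘ₗ g ∘ₗ I.projection _ hIHR, fun v hv => ?_, fun v hv => ?_, fun v hv => ?_⟩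
  · have h0 : I.projection _ hIHR v = 0 := by
      rw [← Submodule.coe_projectionOnto_apply,
        (Submodule.projectionOnto_apply_eq_zero_iff hIHR).2 (Submodule.mem_sup_left hv)]
      rfl
    simp [h0, -Submodule.coe_projectionOnto_apply]
  · have h0 : I.projection _ hIHR v = 0 := by
      rw [← Submodule.coe_projectionOnto_apply,
        (Submodule.projectionOnto_apply_eq_zero_iff hIHR).2 (Submodule.mem_sup_right hv)]
      rfl
    simp [h0, -Submodule.coe_projectionOnto_apply]
  · have h1 : I.projection _ hIHR (d v) = d v := by
      rw [← Submodule.coe_projectionOnto_apply, Submodule.projectionOnto_apply_of_mem_left hIHR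
        (hI ▸ LinearMap.mem_range_self d v)]
    have h2 := LinearMap.congr_fun hg ⟨v, hv⟩
    simp only [LinearMap.comp_apply, Submodule.subtype_apply, LinearMap.id_apply] at h2
    simp only [LinearMap.comp_apply, Submodule.subtype_apply, h1, h2]

/-- The sum `(B ⊗̂ H) + d_q(B ⊗̂ R) + (B ⊗̂ R)` is direct and `d_q` is injective on `B ⊗̂ R`. -/
theorem eq_zero_of_add_map_add_eq_zero
    {B : Type} [CommRing B] [Algebra ℂ B] [IsNoetherianRing B] [IsLocalRing B]
    {V : Type} [AddCommGroup V] [Module ℂ V] {H I R : Submodule ℂ V} {d : V →ₗ[ℂ] V}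
    (hsup : H ⊔ I ⊔ R = ⊤) (hdisjH : Disjoint H (I ⊔ R)) (hdisjIR : Disjoint I R)
    (hI : I = LinearMap.range d) (hker : LinearMap.ker d = H ⊔ I)
    {dq : CTP B V →ₗ[B] CTP B V}
    (hlead : ∀ v : V, dq (iota B V v) - iota B V (d v) ∈ mpow B V 1)
    {h r r' : CTP B V} (hh : h ∈ csub B V H) (hr : r ∈ csub B V R) (hr' : r' ∈ csub B V R)
    (hsum : h + dq r + r' = 0) : h = 0 ∧ r = 0 ∧ r' = 0 := by
  obtain ⟨s, hsH, hsR, hsd⟩ := exists_contraction hsup hdisjH hdisjIR hI hker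
  have hδ (v : V) : (dq - completedMap B d) (iota B V v) ∈ mpow B V 1 := by
    rw [LinearMap.sub_apply, completedMap_iota]
    exact hlead v
  have hfix : completedMap B s ((dq - completedMap B d) r) = -r := by
    have e1 : completedMap B s h = 0 := by
      rw [completedMap_eq_of_mem_csub (g := 0) hsH hh, completedMap_zero]
    have e2 : completedMap B s r' = 0 := by
      rw [completedMap_eq_of_mem_csub (g := 0) hsR hr', completedMap_zero]
    have e3 : completedMap B s (completedMap B d r) = r := by
      rw [completedMap_comp_apply, completedMap_eq_of_mem_csub (g := LinearMap.id) hsd hr,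
        completedMap_id]
    have e4 := congrArg (completedMap B s) hsum
    rw [map_add, map_add, e1, e2, zero_add, add_zero, map_zero] at e4
    rw [LinearMap.sub_apply, map_sub, e3, e4, zero_sub]
  have hr0 : r = 0 := by
    refine eq_zero_of_forall_mem_mpow fun k => ?_
    induction k with
    | zero =>
      rw [mpow_eq_pow_smul_top, pow_zero, Ideal.one_eq_top, Submodule.top_smul]
      exact Submodule.mem_top
    | succ k ih =>
      rw [← neg_mem_iff, ← hfix]
      exact completedMap_mem_mpow s (map_mem_mpow_succ hδ ih)
  subst hr0
  rw [map_zero, add_zero] at hsum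
  have hHR : IsCompl H (I ⊔ R) := ⟨hdisjH, codisjoint_iff.2 (by rw [← sup_assoc, hsup])⟩
  have e1 : completedMap B (H.projection _ hHR) h = h := by
    rw [completedMap_eq_of_mem_csub (g := LinearMap.id) (fun w hw => ?_) hh, completedMap_id]
    rw [← Submodule.coe_projectionOnto_apply, Submodule.projectionOnto_apply_of_mem_left hHR hw]
    rfl
  have e2 : completedMap B (H.projection _ hHR) r' = 0 := by
    rw [completedMap_eq_of_mem_csub (g := 0) (fun w hw => ?_) hr', completedMap_zero]
    rw [← Submodule.coe_projectionOnto_apply,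
      (Submodule.projectionOnto_apply_eq_zero_iff hHR).2 (Submodule.mem_sup_right hw)]
    rfl
  have e3 := congrArg (completedMap B (H.projection _ hHR)) hsum
  rw [map_add, e1, e2, add_zero, map_zero] at e3
  subst e3
  exact ⟨rfl, rfl, by rwa [zero_add] at hsum⟩

/-- Assume `d_q ∘ d_q = 0`, and let `π_H` be the projection of
`B ⊗̂ V` onto `B ⊗̂ H` along `d_q(B ⊗̂ R) ⊕ (B ⊗̂ R)`.  Then `π_H ∘ d_q = D ∘ π_H`;
the map `ψ : h ↦ h - E h` satisfies `d_q ∘ ψ = ψ ∘ D` on `B ⊗̂ H`; `π_H` maps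
`ker d_q` into `ker D` and `range d_q` into `range D = D(B ⊗̂ H)`; and the induced
map `ker d_q / range d_q → ker D / range D`, `[x] ↦ [π_H x]`, is an isomorphism, with
inverse induced by `ψ` (expressed elementwise below). -/
theorem cohomology_comparison
    (B : Type) [CommRing B] [Algebra ℂ B] [IsNoetherianRing B] [IsLocalRing B]
    [IsAdicComplete (maximalIdeal B) B]
    (hres : Function.Bijective (algebraMap ℂ (ResidueField B)))
    (V : Type) [AddCommGroup V] [Module ℂ V]
    (H I R : Submodule ℂ V) (d : V →ₗ[ℂ] V)
    (hsup : H ⊔ I ⊔ R = ⊤)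
    (hdisjH : Disjoint H (I ⊔ R)) (hdisjIR : Disjoint I R)
    (hI : I = LinearMap.range d)
    (hker : LinearMap.ker d = H ⊔ I)
    (dq : CTP B V →ₗ[B] CTP B V)
    (hlead : ∀ v : V, dq (iota B V v) - iota B V (d v) ∈ mpow B V 1)
    (D E F : CTP B V →ₗ[B] CTP B V)
    (hD : ∀ h ∈ csub B V H, D h ∈ csub B V H)
    (hE : ∀ h ∈ csub B V H, E h ∈ csub B V R)
    (hF : ∀ h ∈ csub B V H, F h ∈ csub B V R)
    (hDEF : ∀ h ∈ csub B V H, dq h = D h + dq (E h) + F h)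
    (hdq2 : ∀ x : CTP B V, dq (dq x) = 0)
    (πH : CTP B V →ₗ[B] CTP B V)
    (hπ1 : ∀ x : CTP B V, πH x ∈ csub B V H)
    (hπ2 : ∀ x : CTP B V, x - πH x ∈ Submodule.map dq (csub B V R) ⊔ csub B V R) :
    -- π_H ∘ d_q = D ∘ π_H
    (∀ x : CTP B V, πH (dq x) = D (πH x)) ∧
    -- d_q ∘ ψ = ψ ∘ D on B ⊗̂ H, where ψ h = h - E h
    (∀ h ∈ csub B V H, dq (h - E h) = D h - E (D h)) ∧
    -- π_H maps ker d_q into ker D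
    (∀ x : CTP B V, dq x = 0 → D (πH x) = 0) ∧
    -- π_H maps range d_q into range D = D(B ⊗̂ H)
    (∀ x : CTP B V, πH (dq x) ∈ Submodule.map D (csub B V H)) ∧
    -- the induced map [x] ↦ [π_H x] on cohomology is injective ...
    (∀ x : CTP B V, dq x = 0 → πH x ∈ Submodule.map D (csub B V H) →
      x ∈ LinearMap.range dq) ∧
    -- ... the inverse-candidate ψ lands in ker d_q and π_H ∘ ψ ≡ id modulo range D ...
    (∀ h ∈ csub B V H, D h = 0 →
      dq (h - E h) = 0 ∧ πH (h - E h) - h ∈ Submodule.map D (csub B V H)) ∧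
    -- ... and ψ ∘ π_H ≡ id modulo range d_q, so the induced map is an isomorphism
    (∀ x : CTP B V, dq x = 0 → x - (πH x - E (πH x)) ∈ LinearMap.range dq) := by
  have huniq : ∀ h ∈ csub B V H, ∀ r ∈ csub B V R, ∀ r' ∈ csub B V R,
      h + dq r + r' = 0 → h = 0 ∧ r = 0 ∧ r' = 0 := fun h hh r hr r' hr' =>
    eq_zero_of_add_map_add_eq_zero hsup hdisjH hdisjIR hI hker hlead hh hr hr'
  have hdec (x : CTP B V) : ∃ r ∈ csub B V R, ∃ r' ∈ csub B V R, x = πH x + dq r + r' := by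
    obtain ⟨_, ⟨r, hr, rfl⟩, r', hr', hx⟩ := Submodule.mem_sup.1 (hπ2 x)
    exact ⟨r, hr, r', hr', by rw [add_assoc, hx, add_sub_cancel]⟩
  have hπ : ∀ h ∈ csub B V H, ∀ r ∈ csub B V R, ∀ r' ∈ csub B V R,
      πH (h + dq r + r') = h := by
    intro h hh r hr r' hr'
    obtain ⟨s, hs, s', hs', hx⟩ := hdec (h + dq r + r')
    have h0 := (huniq _ (sub_mem hh (hπ1 (h + dq r + r'))) _ (sub_mem hr hs) _
      (sub_mem hr' hs') (by
        rw [map_sub]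
        refine Eq.trans ?_ (sub_eq_zero.2 hx)
        abel)).1
    exact (sub_eq_zero.1 h0).symm
  have hFE : ∀ h ∈ csub B V H, F h = -E (D h) := by
    intro h hh
    have h0 := hdq2 h
    rw [hDEF h hh, map_add, map_add, hdq2, add_zero, hDEF _ (hD h hh)] at h0
    have h1 := (huniq _ (hD _ (hD h hh)) _ (add_mem (hE _ (hD h hh)) (hF h hh)) _
      (hF _ (hD h hh)) (by rw [map_add, ← h0]; abel)).2.1
    exact eq_neg_of_add_eq_zero_right h1
  have hψ : ∀ h ∈ csub B V H, dq (h - E h) = D h - E (D h) := by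
    intro h hh
    rw [map_sub, hDEF h hh, hFE h hh]
    abel
  have hcomm (x : CTP B V) : πH (dq x) = D (πH x) := by
    obtain ⟨r, hr, r', hr', hx⟩ := hdec x
    have h0 : dq x = D (πH x) + dq (E (πH x) + r') + F (πH x) := by
      conv_lhs => rw [hx]
      rw [map_add, map_add, hdq2, hDEF _ (hπ1 x), map_add]
      abel
    rw [h0]
    exact hπ _ (hD _ (hπ1 x)) _ (add_mem (hE _ (hπ1 x)) hr') _ (hF _ (hπ1 x))
  have hinj : ∀ r ∈ csub B V R, dq r = 0 → r = 0 := fun r hr h0 =>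
    (huniq 0 (zero_mem _) r hr 0 (zero_mem _) (by rw [h0, add_zero, add_zero])).2.1
  have hkerD (x : CTP B V) (hx : dq x = 0) : D (πH x) = 0 := by
    rw [← hcomm, hx, map_zero]
  refine ⟨hcomm, hψ, hkerD, fun x => ?_, ?_, ?_, ?_⟩
  · exact ⟨πH x, hπ1 x, (hcomm x).symm⟩
  · rintro x hx ⟨h, hh, hxh⟩
    obtain ⟨r, hr, r', hr', hdx⟩ := hdec x
    have hy : x = dq (h - E h + r) + (E (D h) + r') := by
      rw [map_add, hψ h hh]
      conv_lhs => rw [hdx, ← hxh]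
      abel
    have h0 : dq (E (D h) + r') = 0 := by
      rwa [hy, map_add, hdq2, zero_add] at hx
    refine ⟨h - E h + r, ?_⟩
    conv_rhs => rw [hy, hinj _ (add_mem (hE _ (hD h hh)) hr') h0, add_zero]
  · intro h hh hDh
    refine ⟨by rw [hψ h hh, hDh, map_zero, sub_zero], ?_⟩
    have h0 := hπ h hh 0 (zero_mem _) (-E h) (neg_mem (hE h hh))
    rw [map_zero, add_zero, ← sub_eq_add_neg] at h0
    rw [h0, sub_self]
    exact zero_mem _
  · intro x hx
    obtain ⟨r, hr, r', hr', hdx⟩ := hdec x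
    have hy : x - (πH x - E (πH x)) = dq r + (r' + E (πH x)) := by
      refine sub_eq_iff_eq_add.2 (hdx.trans ?_)
      abel
    have h0 : dq (r' + E (πH x)) = 0 := by
      have h1 := congrArg dq hy
      rw [map_sub, hx, hψ _ (hπ1 x), hkerD x hx, map_zero, sub_zero, sub_zero, map_add, hdq2,
        zero_add] at h1
      exact h1.symm
    rw [hy, hinj _ (add_mem hr' (hE _ (hπ1 x))) h0, add_zero]
    exact LinearMap.mem_range_self dq r
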